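/- arXiv:math-ph/0402075 — 3 statements merged into one kernel-verified Lean document; each statement's English description precedes it below -/
import Mathlib

section
/- Let F be a complex Hilbert space and let κ ∈ L²(ℝᵈ; F) (a Bochner square-integrable F-valued function on ℝᵈ). Let T_κ : L²(ℝᵈ) → F be the bounded linear operator defined by T_κ f = ∫_{ℝᵈ} f(k) κ(k) dk (Bochner integral). Then for every Hilbert basis (e_m)_{m∈M} of L²(ℝᵈ) one has ∑'_{m∈M} ‖T_κ e_m‖² = ∫_{ℝᵈ} ‖κ(k)‖² dk. In particular T_κ is a Hilbert–Schmidt operator whose Hilbert–Schmidt norm squared equals ∫ ‖κ(k)‖² dk, independently of the chosen orthonormal basis of L²(ℝᵈ). -/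
open MeasureTheory

open scoped ENNReal InnerProductSpace

/-- Parseval's identity in `ℝ≥0∞`. -/
theorem HilbertBasis.tsum_enorm_inner_sq {ι 𝕜 E : Type*} [RCLike 𝕜] [NormedAddCommGroup E]
    [InnerProductSpace 𝕜 E] (b : HilbertBasis ι 𝕜 E) (x : E) :
    ∑' i, ‖⟪b i, x⟫_𝕜‖ₑ ^ 2 = ‖x‖ₑ ^ 2 := by
  have h : HasSum (fun i ↦ ‖⟪b i, x⟫_𝕜‖ ^ 2) (‖x‖ ^ 2) := by
    have := RCLike.hasSum_re 𝕜 (b.hasSum_inner_mul_inner x x)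
    simpa only [inner_mul_symm_re_eq_norm, norm_mul, norm_inner_symm x, ← pow_two,
      inner_self_eq_norm_sq] using this
  have h' := congrArg ENNReal.ofReal h.tsum_eq
  rw [ENNReal.ofReal_tsum_of_nonneg (fun _ ↦ by positivity) h.summable] at h'
  simpa only [ENNReal.ofReal_pow (norm_nonneg _), ofReal_norm] using h'

/-- Only countably many vectors of a Hilbert basis fail to be orthogonal to a separable set. -/
theorem HilbertBasis.exists_countable_inner_eq_zero {ι 𝕜 E : Type*} [RCLike 𝕜]
    [NormedAddCommGroup E] [InnerProductSpace 𝕜 E] (b : HilbertBasis ι 𝕜 E) {s : Set E}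
    (hs : TopologicalSpace.IsSeparable s) :
    ∃ C : Set ι, C.Countable ∧ ∀ i ∉ C, ∀ x ∈ s, ⟪b i, x⟫_𝕜 = 0 := by
  obtain ⟨c, hc, hsc⟩ := hs
  refine ⟨⋃ x ∈ c, Function.support fun i ↦ ‖⟪b i, x⟫_𝕜‖ₑ ^ 2, hc.biUnion fun x _ ↦ ?_, ?_⟩
  · refine Summable.countable_support_ennreal ?_
    rw [b.tsum_enorm_inner_sq]
    finiteness
  · intro i hi x hx
    have hcl : IsClosed {y : E | ⟪b i, y⟫_𝕜 = 0} :=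
      isClosed_eq (by fun_prop) continuous_const
    refine closure_minimal (fun y hy ↦ ?_) hcl (hsc hx)
    by_contra hne
    exact hi (Set.mem_biUnion hy (by simpa using hne))

section

variable {α 𝕜 F : Type*} [RCLike 𝕜] [MeasurableSpace α] {μ : Measure α}
  [NormedAddCommGroup F] [InnerProductSpace 𝕜 F]

theorem MeasureTheory.Lp.lintegral_enorm_sq (f : Lp F 2 μ) :
    ∫⁻ x, ‖f x‖ₑ ^ 2 ∂μ = ‖f‖ₑ ^ 2 := by
  rw [Lp.enorm_def, eLpNorm_eq_lintegral_rpow_enorm_toReal (by simp) (by simp)]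
  rw [← ENNReal.rpow_natCast, ← ENNReal.rpow_mul]
  simp

/-- `∑ ‖⟪y, ∫ eₘ κ⟫‖² = ∫ ‖⟪y, κ⟫‖²` for a Hilbert basis `e` of `L²`. -/
theorem HilbertBasis.tsum_enorm_inner_integral_smul_sq [CompleteSpace F] [NormedSpace ℝ F]
    {M : Type*} (e : HilbertBasis M 𝕜 (Lp 𝕜 2 μ)) (κ : Lp F 2 μ) (y : F) :
    ∑' m, ‖⟪y, ∫ k, e m k • κ k ∂μ⟫_𝕜‖ₑ ^ 2 = ∫⁻ k, ‖⟪y, κ k⟫_𝕜‖ₑ ^ 2 ∂μ := by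
  have hg : MemLp (fun k ↦ ⟪κ k, y⟫_𝕜) 2 μ := (Lp.memLp κ).inner_const y
  have hint (f : Lp 𝕜 2 μ) : Integrable (fun k ↦ f k • κ k) μ :=
    memLp_one_iff_integrable.1 ((Lp.memLp κ).smul (Lp.memLp f))
  have hinner (f : Lp 𝕜 2 μ) : ⟪y, ∫ k, f k • κ k ∂μ⟫_𝕜 = ⟪hg.toLp, f⟫_𝕜 := by
    rw [← integral_inner (hint f), L2.inner_def]
    refine integral_congr_ae ?_
    filter_upwards [hg.coeFn_toLp] with k hk
    simp [hk, inner_smul_right]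
  simp only [hinner, ← ofReal_norm, norm_inner_symm hg.toLp]
  simp only [ofReal_norm, e.tsum_enorm_inner_sq, ← Lp.lintegral_enorm_sq]
  refine lintegral_congr_ae ?_
  filter_upwards [hg.coeFn_toLp] with k hk
  rw [hk, ← ofReal_norm, norm_inner_symm, ofReal_norm]

/-- The Hilbert–Schmidt norm of `f ↦ ∫ f κ` is the `L²` norm of `κ`. -/
theorem HilbertBasis.tsum_enorm_integral_smul_sq [CompleteSpace F] [NormedSpace ℝ F]
    {M : Type*} (e : HilbertBasis M 𝕜 (Lp 𝕜 2 μ)) (κ : Lp F 2 μ) :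
    ∑' m, ‖∫ k, e m k • κ k ∂μ‖ₑ ^ 2 = ∫⁻ k, ‖κ k‖ₑ ^ 2 ∂μ := by
  obtain ⟨w, b, -⟩ := exists_hilbertBasis 𝕜 F
  obtain ⟨C, hC, hC0⟩ :=
    b.exists_countable_inner_eq_zero (Lp.stronglyMeasurable κ).isSeparable_range
  have := hC.to_subtype
  have hsupp (k : α) : (Function.support fun i ↦ ‖⟪b i, κ k⟫_𝕜‖ₑ ^ 2) ⊆ C := by
    refine Function.support_subset_iff'.2 fun i hi ↦ ?_
    simp [hC0 i hi _ ⟨k, rfl⟩]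
  have hsupp' : (Function.support fun i ↦ ∫⁻ k, ‖⟪b i, κ k⟫_𝕜‖ₑ ^ 2 ∂μ) ⊆ C := by
    refine Function.support_subset_iff'.2 fun i hi ↦ ?_
    simp [hC0 i hi _ ⟨_, rfl⟩]
  calc ∑' m, ‖∫ k, e m k • κ k ∂μ‖ₑ ^ 2
      = ∑' m, ∑' i, ‖⟪b i, ∫ k, e m k • κ k ∂μ⟫_𝕜‖ₑ ^ 2 := by
        simp only [b.tsum_enorm_inner_sq]
    _ = ∑' i, ∫⁻ k, ‖⟪b i, κ k⟫_𝕜‖ₑ ^ 2 ∂μ := by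
        rw [ENNReal.tsum_comm]
        simp only [e.tsum_enorm_inner_integral_smul_sq]
    _ = ∑' i : C, ∫⁻ k, ‖⟪b i, κ k⟫_𝕜‖ₑ ^ 2 ∂μ := (tsum_subtype_eq_of_support_subset hsupp').symm
    _ = ∫⁻ k, ∑' i : C, ‖⟪b i, κ k⟫_𝕜‖ₑ ^ 2 ∂μ := by
        refine (lintegral_tsum fun i ↦ ?_).symm
        exact ((Lp.aestronglyMeasurable κ).const_inner).enorm.pow_const 2
    _ = ∫⁻ k, ‖κ k‖ₑ ^ 2 ∂μ := by
        refine lintegral_congr fun k ↦ ?_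
        rw [tsum_subtype_eq_of_support_subset (hsupp k), b.tsum_enorm_inner_sq]

end

/-- Proposition 2.3(2): for `κ ∈ L²(ℝᵈ; F)` and the operator `T f = ∫ f(k) • κ(k) dk`,
for every Hilbert basis `(e m)` of `L²(ℝᵈ)` one has
`∑' m, ‖T (e m)‖² = ∫ ‖κ k‖² dk` (in `[0,∞]`); in particular `T` is Hilbert–Schmidt
with Hilbert–Schmidt norm squared `∫ ‖κ‖²`, independently of the basis. -/
theorem stmt_1 {d : ℕ} {F : Type*} [NormedAddCommGroup F] [InnerProductSpace ℂ F]
    [CompleteSpace F]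
    (κ : Lp F 2 (volume : Measure (EuclideanSpace ℝ (Fin d))))
    (T : Lp ℂ 2 (volume : Measure (EuclideanSpace ℝ (Fin d))) →L[ℂ] F)
    (hT : ∀ f : Lp ℂ 2 (volume : Measure (EuclideanSpace ℝ (Fin d))),
      T f = ∫ k : EuclideanSpace ℝ (Fin d),
        (f : EuclideanSpace ℝ (Fin d) → ℂ) k • (κ : EuclideanSpace ℝ (Fin d) → F) k)
    {M : Type*}
    (e : HilbertBasis M ℂ (Lp ℂ 2 (volume : Measure (EuclideanSpace ℝ (Fin d))))) :
    ∑' m : M, (‖T (e m)‖₊ : ENNReal) ^ 2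
      = ∫⁻ k : EuclideanSpace ℝ (Fin d),
          (‖(κ : EuclideanSpace ℝ (Fin d) → F) k‖₊ : ENNReal) ^ 2 := by
  simpa only [hT, enorm_eq_nnnorm] using e.tsum_enorm_integral_smul_sq κ
end

section
/- Let h : ℝ³ → ℂ be a smooth (C^∞) function with compact support disjoint from the union of the coordinate hyperplanes ⋃_{n=1}^{3} {k ∈ ℝ³ : k_n = 0} (in particular 0 ∉ supp h). Then there exist constants c₁ ≥ 0 and c₂ ≥ 0 such that for every s > 0 and every x ∈ ℝ³, |∫_{ℝ³} e^{-i( s|k| + ⟨k,x⟩ )} h(k) dk| ≤ (c₁ + c₂|x|) / ( s(1 + s) ), where ⟨k,x⟩ is the Euclidean inner product and |x| the Euclidean norm. -/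
open MeasureTheory
open scoped RealInnerProductSpace

/-- One integration by parts along a ray orthogonal to its base point `a`: the polar weight `r`
compensates the degeneracy of the phase `s‖a + r e‖` at `r = 0`. -/
theorem norm_integral_ray_le {E : Type*} [NormedAddCommGroup E] [InnerProductSpace ℝ E]
    {g G : E → ℂ} (hg : Continuous g) (hG : ContDiff ℝ 1 G)
    (hGg : ∀ k, G k = (‖k‖ : ℂ) * g k) {R M M' : ℝ} (hR : 0 ≤ R)
    (hgR : ∀ k, R ≤ ‖k‖ → g k = 0) (hM : ∀ k, ‖G k‖ ≤ M) (hM' : ∀ k, ‖fderiv ℝ G k‖ ≤ M')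
    {a e : E} (hae : ⟪a, e⟫ = 0) (he : ‖e‖ = 1) (c : ℝ) {s : ℝ} (hs : 0 < s) :
    ‖∫ r in Set.Ioi (0 : ℝ), r • (Complex.exp (-Complex.I * ((s * ‖a + r • e‖ + c : ℝ) : ℂ))
      * g (a + r • e))‖ ≤ (M + M' * R) / s := by
  have hnorm : ∀ r : ℝ, ‖a + r • e‖ = √(‖a‖ ^ 2 + r ^ 2) := by
    intro r
    rw [eq_comm, Real.sqrt_eq_iff_eq_sq (by positivity) (by positivity), norm_add_sq_real,
      inner_smul_right, hae, norm_smul, he]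
    simp
  have hle : ∀ r : ℝ, 0 ≤ r → r ≤ ‖a + r • e‖ := fun r hr => by
    rw [hnorm]; exact Real.le_sqrt_of_sq_le (by nlinarith [sq_nonneg ‖a‖])
  set A : ℝ → ℂ := fun r => Complex.exp (-Complex.I * ((s * ‖a + r • e‖ + c : ℝ) : ℂ)) with hA
  have hAn : ∀ r, ‖A r‖ = 1 := fun r => by
    rw [hA]; simp only
    rw [show -Complex.I * ((s * ‖a + r • e‖ + c : ℝ) : ℂ)
      = ((-(s * ‖a + r • e‖ + c) : ℝ) : ℂ) * Complex.I by push_cast; ring]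
    exact Complex.norm_exp_ofReal_mul_I _
  have hAc : Continuous A := by fun_prop
  have hGd : Continuous (fderiv ℝ G) := hG.continuous_fderiv (by norm_num)
  have hGc : Continuous G := hG.continuous
  set D : ℝ → ℂ := fun r => A r * fderiv ℝ G (a + r • e) e with hD
  have hDc : Continuous D := by
    refine hAc.mul ?_
    exact (hGd.comp (by fun_prop)).clm_apply continuous_const
  have hFc : Continuous (fun r : ℝ => r • (A r * g (a + r • e))) := by fun_prop
  have hder : ∀ r ∈ Set.Ioo 0 R, HasDerivAt (fun r => A r * G (a + r • e))
      (-(Complex.I * s) * (r • (A r * g (a + r • e))) + D r) r := by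
    intro r hr
    have hpos : 0 < ‖a‖ ^ 2 + r ^ 2 := by have := hr.1; positivity
    have h1 : HasDerivAt (fun r => ‖a + r • e‖) (r / ‖a + r • e‖) r := by
      simp_rw [hnorm]
      refine (((hasDerivAt_pow 2 r).const_add (‖a‖ ^ 2)).sqrt hpos.ne').congr_deriv ?_
      push_cast
      field_simp
    have h2 : HasDerivAt A (A r * (-Complex.I * ((s * (r / ‖a + r • e‖) : ℝ) : ℂ))) r := by
      have := (((h1.const_mul s).add_const c).ofReal_comp.const_mul (-Complex.I)).cexp
      exact this
    have h3 : HasDerivAt (fun r : ℝ => G (a + r • e)) (fderiv ℝ G (a + r • e) e) r := by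
      have hl : HasDerivAt (fun r : ℝ => a + r • e) e r := by
        simpa using ((hasDerivAt_id r).smul_const e).const_add a
      exact ((hG.differentiable (by norm_num)) _).hasFDerivAt.comp_hasDerivAt r hl
    refine (h2.mul h3).congr_deriv ?_
    rw [hGg (a + r • e)]
    have hne : (‖a + r • e‖ : ℂ) ≠ 0 := by
      have := hle r hr.1.le
      have := hr.1
      exact_mod_cast (by linarith : 0 < ‖a + r • e‖).ne'
    simp only [hD, Complex.real_smul]
    push_cast
    field_simp
  have hftc := intervalIntegral.integral_eq_sub_of_hasDerivAt_of_le hR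
    (f := fun r => A r * G (a + r • e)) (by fun_prop) hder
    (Continuous.intervalIntegrable (by fun_prop) _ _)
  have hRz : g (a + R • e) = 0 := hgR _ (hle R hR)
  rw [intervalIntegral.integral_add (Continuous.intervalIntegrable (by fun_prop) _ _)
    (Continuous.intervalIntegrable (by fun_prop) _ _), intervalIntegral.integral_const_mul,
    hGg (a + R • e), hRz] at hftc
  have hset : ∫ r in Set.Ioi (0 : ℝ), r • (A r * g (a + r • e))
      = ∫ r in (0 : ℝ)..R, r • (A r * g (a + r • e)) := by
    rw [intervalIntegral.integral_of_le hR]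
    refine setIntegral_eq_of_subset_of_forall_sdiff_eq_zero measurableSet_Ioi
      Set.Ioc_subset_Ioi_self ?_
    rintro r ⟨hr0, hr⟩
    have hr0 : 0 < r := hr0
    have : R < r := by by_contra! hh; exact hr ⟨hr0, hh⟩
    rw [hgR _ (this.le.trans (hle r hr0.le))]; simp
  have hDn : ‖∫ r in (0 : ℝ)..R, D r‖ ≤ M' * R := by
    have := intervalIntegral.norm_integral_le_of_norm_le_const (a := (0 : ℝ)) (b := R) (f := D)
      (C := M') (fun r _ => by
        rw [hD]; simp only [norm_mul, hAn, one_mul]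
        exact ((fderiv ℝ G _).le_opNorm e).trans (by rw [he, mul_one]; exact hM' _))
    simpa [abs_of_nonneg hR] using this
  change ‖∫ r in Set.Ioi (0 : ℝ), r • (A r * g (a + r • e))‖ ≤ _
  rw [hset, le_div_iff₀ hs]
  set X := ∫ r in (0 : ℝ)..R, r • (A r * g (a + r • e))
  have : Complex.I * s * X = A 0 * G (a + (0 : ℝ) • e) + ∫ r in (0 : ℝ)..R, D r := by
    linear_combination -hftc
  calc ‖X‖ * s = ‖Complex.I * s * X‖ := by
        simp [abs_of_pos hs]; ring
    _ ≤ _ := by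
        rw [this]
        refine (norm_add_le _ _).trans (add_le_add ?_ hDn)
        rw [norm_mul, hAn, one_mul]; exact hM _

theorem OrthonormalBasis.integral_eq_integral_prod_prod {E : Type*} [NormedAddCommGroup E]
    [InnerProductSpace ℝ E] [FiniteDimensional ℝ E] [MeasurableSpace E] [BorelSpace E]
    (b : OrthonormalBasis (Fin 3) ℝ E) (F : E → ℂ) :
    ∫ k, F k = ∫ p : ℝ × ℝ × ℝ, F (p.1 • b 0 + p.2.1 • b 1 + p.2.2 • b 2) := by
  rw [← b.measurePreserving_repr_symm.integral_comp b.repr.symm.toHomeomorph.measurableEmbedding,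
    ← (PiLp.volume_preserving_toLp (Fin 3)).integral_comp
      (MeasurableEquiv.toLp 2 (Fin 3 → ℝ)).measurableEmbedding]
  have h1 := (volume_preserving_piFinSuccAbove (fun _ : Fin 3 => ℝ) 0).symm
  have h2 := (MeasurePreserving.id (volume : Measure ℝ)).prod
    (volume_preserving_finTwoArrow ℝ).symm
  rw [← h1.integral_comp (MeasurableEquiv.measurableEmbedding _)]
  erw [← h2.integral_comp (((MeasurableEquiv.refl ℝ).prodCongr
    (MeasurableEquiv.finTwoArrow (α := ℝ)).symm).measurableEmbedding)]
  refine integral_congr_ae (Filter.Eventually.of_forall fun p => ?_)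
  beta_reduce
  rw [← b.sum_repr_symm, Fin.sum_univ_three]
  rfl

theorem exists_orthonormalBasis_smul_eq (x : EuclideanSpace ℝ (Fin 3)) :
    ∃ b : OrthonormalBasis (Fin 3) ℝ (EuclideanSpace ℝ (Fin 3)), x = ‖x‖ • b 0 := by
  rcases eq_or_ne x 0 with rfl | hx
  · exact ⟨EuclideanSpace.basisFun _ _, by simp⟩
  have ho : Orthonormal ℝ (({0} : Set (Fin 3)).domRestrict (fun _ => ‖x‖⁻¹ • x)) := by
    refine ⟨fun _ => ?_, fun i j hij => (hij (Subsingleton.elim _ _)).elim⟩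
    simp [norm_smul, hx]
  obtain ⟨b, hb⟩ := ho.exists_orthonormalBasis_extension_of_card_eq (by simp)
  exact ⟨b, by simp [hb 0 rfl, smul_smul, hx]⟩
theorem contDiff_mul_of_tsupport {E : Type*} [NormedAddCommGroup E] [NormedSpace ℝ E] {n : ℕ∞}
    {u g : E → ℂ} (hg : ContDiff ℝ n g) (hu : ∀ k ∈ tsupport g, ContDiffAt ℝ n u k) :
    ContDiff ℝ n fun k => u k * g k := by
  refine contDiff_iff_contDiffAt.2 fun k => ?_
  by_cases hk : k ∈ tsupport g
  · exact (hu k hk).mul hg.contDiffAt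
  · refine (contDiffAt_const (c := (0 : ℂ))).congr_of_eventuallyEq ?_
    filter_upwards [notMem_tsupport_iff_eventuallyEq.1 hk] with y hy
    simp [hy]

/-- Dispersive estimate, uniform in `x`: use cylindrical coordinates around the axis `x` and
integrate by parts in the distance to the axis. -/
theorem exists_norm_integral_exp_mul_le {g : EuclideanSpace ℝ (Fin 3) → ℂ}
    (hg : ContDiff ℝ 1 g) (hc : HasCompactSupport g)
    (h0 : (0 : EuclideanSpace ℝ (Fin 3)) ∉ tsupport g) :
    ∃ C : ℝ, 0 ≤ C ∧ ∀ s : ℝ, 0 < s → ∀ x : EuclideanSpace ℝ (Fin 3),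
      ‖∫ k, Complex.exp (-Complex.I * ((s * ‖k‖ + ⟪k, x⟫ : ℝ) : ℂ)) * g k‖ ≤ C / (1 + s) := by
  obtain ⟨R, hR0, hR⟩ : ∃ R : ℝ, 0 < R ∧ ∀ k, R ≤ ‖k‖ → g k = 0 := by
    obtain ⟨R, hR0, hR⟩ := hc.isCompact.isBounded.subset_ball_lt 0 0
    refine ⟨R, hR0, fun k hk => image_eq_zero_of_notMem_tsupport fun hk' => ?_⟩
    have := hR hk'
    rw [mem_ball_zero_iff] at this
    linarith
  have hgc : Continuous g := hg.continuous
  set G : EuclideanSpace ℝ (Fin 3) → ℂ := fun k => (‖k‖ : ℂ) * g k with hGdef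
  have hG : ContDiff ℝ 1 G := contDiff_mul_of_tsupport hg fun k hk =>
    Complex.ofRealCLM.contDiff.contDiffAt.comp k (contDiffAt_norm ℝ (by rintro rfl; exact h0 hk))
  have hGs : HasCompactSupport G := hc.mul_left
  obtain ⟨M, hM⟩ := hG.continuous.bounded_above_of_compact_support hGs
  obtain ⟨M', hM'⟩ := (hG.continuous_fderiv (by norm_num)).bounded_above_of_compact_support
    (hGs.fderiv (𝕜 := ℝ))
  have hMM : 0 ≤ M + M' * R := by
    have := (norm_nonneg _).trans (hM 0)
    have := (norm_nonneg _).trans (hM' 0)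
    positivity
  have hexp : ∀ t : ℝ, ‖Complex.exp (-Complex.I * (t : ℂ))‖ = 1 := fun t => by
    rw [show -Complex.I * (t : ℂ) = ((-t : ℝ) : ℂ) * Complex.I by push_cast; ring]
    exact Complex.norm_exp_ofReal_mul_I _
  set C₀ := ∫ k, ‖g k‖
  set C₁ := (M + M' * R) * (2 * Real.pi) * (2 * R) with hC₁
  refine ⟨C₀ + C₁, by positivity, fun s hs x => ?_⟩
  set F : EuclideanSpace ℝ (Fin 3) → ℂ := fun k =>
    Complex.exp (-Complex.I * ((s * ‖k‖ + ⟪k, x⟫ : ℝ) : ℂ)) * g k with hF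
  have hFc : Continuous F := by fun_prop
  have hFR : ∀ k, R ≤ ‖k‖ → F k = 0 := fun k hk => by simp [hF, hR k hk]
  have hA : ‖∫ k, F k‖ ≤ C₀ := by
    refine (norm_integral_le_integral_norm _).trans_eq ?_
    simp only [hF, norm_mul, hexp, one_mul, C₀]
  have hB : ‖∫ k, F k‖ ≤ C₁ / s := by
    obtain ⟨b, hb⟩ := exists_orthonormalBasis_smul_eq x
    have hb01 : ⟪b 0, b 1⟫ = 0 := b.orthonormal.2 (by decide)
    have hb02 : ⟪b 0, b 2⟫ = 0 := b.orthonormal.2 (by decide)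
    have hb12 : ⟪b 1, b 2⟫ = 0 := b.orthonormal.2 (by decide)
    have hb0 : ‖b 0‖ = 1 := b.norm_eq_one 0
    have hb1 : ‖b 1‖ = 1 := b.norm_eq_one 1
    have hb2 : ‖b 2‖ = 1 := b.norm_eq_one 2
    have hnsq : ∀ z u v : ℝ, ‖z • b 0 + u • b 1 + v • b 2‖ ^ 2 = z ^ 2 + u ^ 2 + v ^ 2 := by
      intro z u v
      simp only [norm_add_sq_real, inner_add_left, inner_smul_left, inner_smul_right, norm_smul,
        hb01, hb02, hb12, hb0, hb1, hb2, Real.norm_eq_abs, mul_one, sq_abs]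
      simp
    have hT0 : ∀ z u v : ℝ, R ^ 2 ≤ z ^ 2 + u ^ 2 + v ^ 2 →
        F (z • b 0 + u • b 1 + v • b 2) = 0 := fun z u v h =>
      hFR _ (le_of_sq_le_sq (by rw [hnsq]; exact h) (norm_nonneg _))
    have hint : Integrable (fun p : ℝ × ℝ × ℝ => F (p.1 • b 0 + p.2.1 • b 1 + p.2.2 • b 2))
        (volume.prod volume) := by
      refine Continuous.integrable_of_hasCompactSupport (by fun_prop) (HasCompactSupport.intro
        (K := Set.Icc (-R) R ×ˢ (Set.Icc (-R) R ×ˢ Set.Icc (-R) R))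
        (isCompact_Icc.prod (isCompact_Icc.prod isCompact_Icc)) ?_)
      rintro ⟨z, u, v⟩ hp
      refine hT0 _ _ _ ?_
      by_contra! hlt
      refine hp ⟨abs_le.1 (abs_le_of_sq_le_sq ?_ hR0.le), abs_le.1 (abs_le_of_sq_le_sq ?_ hR0.le),
        abs_le.1 (abs_le_of_sq_le_sq ?_ hR0.le)⟩ <;> simp only <;>
        nlinarith [sq_nonneg z, sq_nonneg u, sq_nonneg v]
    have hslice : ∀ z : ℝ, ‖∫ q : ℝ × ℝ, F (z • b 0 + q.1 • b 1 + q.2 • b 2)‖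
        ≤ (M + M' * R) / s * (2 * Real.pi) := by
      intro z
      rw [← integral_comp_polarCoord_symm, polarCoord_target]
      simp only [polarCoord_symm_apply]
      have hio : IntegrableOn (fun p : ℝ × ℝ => p.1 •
          F (z • b 0 + (p.1 * Real.cos p.2) • b 1 + (p.1 * Real.sin p.2) • b 2))
          (Set.Ioi 0 ×ˢ Set.Ioo (-Real.pi) Real.pi) (volume.prod volume) := by
        refine IntegrableOn.of_forall_sdiff_eq_zero
          (s := Set.Icc 0 R ×ˢ Set.Icc (-Real.pi) Real.pi) ?_
          (measurableSet_Ioi.prod measurableSet_Ioo) ?_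
        · exact ContinuousOn.integrableOn_compact (isCompact_Icc.prod isCompact_Icc)
            (Continuous.continuousOn (by fun_prop))
        · rintro ⟨r, θ⟩ ⟨⟨hr, hθ⟩, hn⟩
          have hr : 0 < r := hr
          have hRr : R < r := by
            by_contra! hle
            exact hn ⟨⟨hr.le, hle⟩, ⟨hθ.1.le, hθ.2.le⟩⟩
          simp only
          rw [hT0, smul_zero]
          have := Real.sin_sq_add_cos_sq θ
          calc R ^ 2 ≤ r ^ 2 := by gcongr
            _ = r ^ 2 * (Real.sin θ ^ 2 + Real.cos θ ^ 2) := by rw [this, mul_one]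
            _ ≤ z ^ 2 + (r * Real.cos θ) ^ 2 + (r * Real.sin θ) ^ 2 := by
              linarith [sq_nonneg z]
      rw [Measure.volume_eq_prod, ← setIntegral_prod_swap, setIntegral_prod _ (by exact hio.swap)]
      refine (norm_setIntegral_le_of_norm_le_const (C := (M + M' * R) / s) (by simp)
        fun θ _ => ?_).trans_eq (by
          rw [Real.volume_real_Ioo_of_le (by linarith [Real.pi_nonneg])]; ring)
      have hray := norm_integral_ray_le hgc hG (fun _ => rfl) hR0.le hR hM hM'
        (a := z • b 0) (e := Real.cos θ • b 1 + Real.sin θ • b 2)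
        (by simp [inner_add_right, inner_smul_left, inner_smul_right, hb01, hb02])
        (by
          have := hnsq 0 (Real.cos θ) (Real.sin θ)
          rw [zero_smul, zero_add] at this
          rw [← sq_eq_sq₀ (norm_nonneg _) zero_le_one, this]
          simp) (z * ‖x‖) hs
      refine (congrArg norm (setIntegral_congr_fun measurableSet_Ioi fun r _ => ?_)).trans_le hray
      have hv : z • b 0 + (r * Real.cos θ) • b 1 + (r * Real.sin θ) • b 2
          = z • b 0 + r • (Real.cos θ • b 1 + Real.sin θ • b 2) := by module
      have hin : ⟪z • b 0 + r • (Real.cos θ • b 1 + Real.sin θ • b 2), x⟫ = z * ‖x‖ := by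
        have hx : ∀ k, ⟪k, x⟫ = ‖x‖ * ⟪k, b 0⟫ := fun k => by
          conv_lhs => rw [hb, inner_smul_right]
        have hb10 : ⟪b 1, b 0⟫ = 0 := by rw [real_inner_comm, hb01]
        have hb20 : ⟪b 2, b 0⟫ = 0 := by rw [real_inner_comm, hb02]
        simp [hx, inner_add_left, inner_smul_left, hb10, hb20, hb0, mul_comm]
      simp only [Prod.swap_prod_mk, hF, hv, hin]
    rw [b.integral_eq_integral_prod_prod, Measure.volume_eq_prod, integral_prod _ hint,
      ← setIntegral_eq_integral_of_forall_compl_eq_zero (s := Set.Icc (-R) R)]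
    · refine (norm_setIntegral_le_of_norm_le_const (by simp) fun z _ => hslice z).trans_eq ?_
      rw [Real.volume_real_Icc_of_le (by linarith), hC₁]
      ring
    · intro z hz
      have hz2 : R ^ 2 ≤ z ^ 2 := by
        by_contra! hlt
        exact hz (abs_le.1 (abs_le_of_sq_le_sq hlt.le hR0.le))
      have : ∀ q : ℝ × ℝ, F (z • b 0 + q.1 • b 1 + q.2 • b 2) = 0 := fun q =>
        hT0 _ _ _ (by nlinarith [sq_nonneg q.1, sq_nonneg q.2])
      simp [this]
  rw [le_div_iff₀ (by positivity)]
  rw [le_div_iff₀ hs] at hB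
  linarith

/-- The oscillatory-integral estimate from the proof of Lemma 4.13 (Pauli–Fierz model):
for smooth compactly supported `h` whose support avoids all coordinate hyperplanes,
`|∫ e^{-i(s|k| + k·x)} h(k) dk| ≤ (c₁ + c₂|x|)/(s(1+s))` for all `s > 0`, `x ∈ ℝ³`. -/
theorem stmt_4 (h : EuclideanSpace ℝ (Fin 3) → ℂ)
    (hsm : ContDiff ℝ (⊤ : ℕ∞) h) (hsupp : HasCompactSupport h)
    (hdisj : ∀ k ∈ tsupport h, ∀ n : Fin 3, k n ≠ 0) :
    ∃ c₁ c₂ : ℝ, 0 ≤ c₁ ∧ 0 ≤ c₂ ∧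
      ∀ s : ℝ, 0 < s → ∀ x : EuclideanSpace ℝ (Fin 3),
        ‖∫ k : EuclideanSpace ℝ (Fin 3),
            Complex.exp (-Complex.I * ((s * ‖k‖ + ⟪k, x⟫ : ℝ) : ℂ)) * h k‖
          ≤ (c₁ + c₂ * ‖x‖) / (s * (1 + s)) := by
  have h0 : (0 : EuclideanSpace ℝ (Fin 3)) ∉ tsupport h := fun hk => hdisj 0 hk 0 rfl
  set v : EuclideanSpace ℝ (Fin 3) := EuclideanSpace.single 0 1
  set g : EuclideanSpace ℝ (Fin 3) → ℂ := fun k => ((‖k‖ / k 0 : ℝ) : ℂ) * h k with hgdef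
  have hg : ContDiff ℝ (⊤ : ℕ∞) g := contDiff_mul_of_tsupport hsm fun k hk => by
    refine Complex.ofRealCLM.contDiff.contDiffAt.comp k ?_
    exact (contDiffAt_norm ℝ (by rintro rfl; exact h0 hk)).div (by fun_prop) (hdisj k hk 0)
  have hgs : tsupport g ⊆ tsupport h := tsupport_mul_subset_right
  have hgcs : HasCompactSupport g := hsupp.mul_left
  have hg0 : (0 : EuclideanSpace ℝ (Fin 3)) ∉ tsupport g := fun hk => h0 (hgs hk)
  set g' : EuclideanSpace ℝ (Fin 3) → ℂ := fun k => fderiv ℝ g k v with hg'def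
  have hg' : ContDiff ℝ 1 g' :=
    (hg.fderiv_right (m := 1) (by norm_cast)).clm_apply contDiff_const
  have hg's : tsupport g' ⊆ tsupport g := tsupport_fderiv_apply_subset ℝ v
  have hg'cs : HasCompactSupport g' := hgcs.fderiv_apply (𝕜 := ℝ) v
  obtain ⟨C₁, hC₁, hJ₁⟩ := exists_norm_integral_exp_mul_le hg' hg'cs fun hk => hg0 (hg's hk)
  obtain ⟨C₂, hC₂, hJ₂⟩ := exists_norm_integral_exp_mul_le (hg.of_le (by norm_cast))
    hgcs hg0
  refine ⟨C₁, C₂, hC₁, hC₂, fun s hs x => ?_⟩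
  have hhc : Continuous h := hsm.continuous
  have hgc : Continuous g := hg.continuous
  have hg'c : Continuous g' := hg'.continuous
  set e : EuclideanSpace ℝ (Fin 3) → ℂ := fun k =>
    Complex.exp (-Complex.I * ((s * ‖k‖ + ⟪k, x⟫ : ℝ) : ℂ)) with he
  have hec : Continuous e := by fun_prop
  have hIh : Integrable fun k => e k * h k :=
    (hec.mul hhc).integrable_of_hasCompactSupport hsupp.mul_left
  have hIg : Integrable fun k => e k * g k :=
    (hec.mul hgc).integrable_of_hasCompactSupport hgcs.mul_left
  have hIg' : Integrable fun k => e k * g' k :=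
    (hec.mul hg'c).integrable_of_hasCompactSupport hg'cs.mul_left
  have hed : ∀ k ∈ tsupport g, HasLineDerivAt ℝ e
      (e k * (-Complex.I * ((s * (k 0 / ‖k‖) + x 0 : ℝ) : ℂ))) k v := by
    intro k hk
    have hk0 : k ≠ 0 := by rintro rfl; exact hg0 hk
    have hl : HasDerivAt (fun t : ℝ => k + t • v) v 0 := by
      simpa using ((hasDerivAt_id (0 : ℝ)).smul_const v).const_add k
    have h1 : HasDerivAt (fun t : ℝ => ‖k + t • v‖) (k 0 / ‖k‖) 0 := by
      have hsq := hl.norm_sq.sqrt (by simpa using hk0)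
      simp only [Real.sqrt_sq (norm_nonneg _)] at hsq
      refine hsq.congr_deriv ?_
      simp [v, EuclideanSpace.inner_single_right]
      field_simp
    have h2 : HasDerivAt (fun t : ℝ => ⟪k + t • v, x⟫) (x 0) 0 := by
      refine (hl.inner ℝ (hasDerivAt_const (0 : ℝ) x)).congr_deriv ?_
      simp [v, EuclideanSpace.inner_single_left]
    have := (((h1.const_mul s).add h2).ofReal_comp.const_mul (-Complex.I)).cexp
    simp only [HasLineDerivAt, he]
    refine this.congr_deriv ?_
    simp
  have hderiv : ∀ k, e k * (-Complex.I * ((s * (k 0 / ‖k‖) + x 0 : ℝ) : ℂ)) * g k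
      = -(Complex.I * s) * (e k * h k) - Complex.I * (x 0) * (e k * g k) := by
    intro k
    by_cases hk : k ∈ tsupport h
    · have hk0 : ((k 0 : ℝ) : ℂ) ≠ 0 := by exact_mod_cast hdisj k hk 0
      have hkn : (‖k‖ : ℂ) ≠ 0 := by
        have : k ≠ 0 := by rintro rfl; exact h0 hk
        exact_mod_cast (norm_ne_zero_iff.2 this)
      simp only [hgdef]
      push_cast
      field_simp
      ring
    · simp [hgdef, image_eq_zero_of_notMem_tsupport hk]
  have hibp := integral_bilinear_hasLineDerivAt_right_eq_neg_left_of_integrable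
    (μ := (volume : Measure (EuclideanSpace ℝ (Fin 3)))) (f := e) (g := g) (g' := g') (v := v)
    (f' := fun k => e k * (-Complex.I * ((s * (k 0 / ‖k‖) + x 0 : ℝ) : ℂ)))
    (B := ContinuousLinearMap.mul ℝ ℂ)
    (by
      simp only [ContinuousLinearMap.mul_apply', hderiv]
      exact (hIh.const_mul _).sub (hIg.const_mul _))
    hIg' hIg hed
    (fun k _ => ((hg.differentiable (by simp)) k).hasFDerivAt.hasLineDerivAt v)
  simp only [ContinuousLinearMap.mul_apply', hderiv] at hibp
  rw [integral_sub (hIh.const_mul _) (hIg.const_mul _), integral_const_mul,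
    integral_const_mul] at hibp
  have hx : |x 0| ≤ ‖x‖ := by simpa using PiLp.norm_apply_le x 0
  change ‖∫ k, e k * h k‖ ≤ _
  rw [mul_comm s, ← div_div, le_div_iff₀ hs]
  calc ‖∫ k, e k * h k‖ * s = ‖Complex.I * s * ∫ k, e k * h k‖ := by
        simp [abs_of_pos hs]; ring
    _ = ‖(∫ k, e k * g' k) - Complex.I * (x 0) * ∫ k, e k * g k‖ := by
        congr 1
        linear_combination -hibp
    _ ≤ ‖∫ k, e k * g' k‖ + |x 0| * ‖∫ k, e k * g k‖ := by
        refine (norm_sub_le _ _).trans_eq ?_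
        simp
    _ ≤ C₁ / (1 + s) + ‖x‖ * (C₂ / (1 + s)) := by
        gcongr
        · exact hJ₁ s hs x
        · exact hJ₂ s hs x
    _ = (C₁ + C₂ * ‖x‖) / (1 + s) := by ring
end

section
/- Let E be a complex inner product space, let c ≥ 0, and let β : E × E → ℂ be a Hermitian sesquilinear form (conjugate-linear in the first argument, linear in the second, with β(Φ,Ψ) = conjugate of β(Ψ,Φ)) satisfying |β(Ψ,Ψ)| ≤ c‖Ψ‖² for all Ψ ∈ E. Let Q : E → E be a linear map with ‖QΨ‖ ≤ ‖Ψ‖ for all Ψ ∈ E. Then |β(QΨ, Ψ)| ≤ 2c‖Ψ‖² for all Ψ ∈ E. -/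
section HermitianForm

variable {E : Type*} [NormedAddCommGroup E] [InnerProductSpace ℂ E] {c : ℝ} {β : E → E → ℂ}

/-- The symmetrization of a Hermitian form is controlled by its quadratic form. -/
lemma norm_add_swap_le_of_norm_self_le
    (hadd : ∀ x y z : E, β x (y + z) = β x y + β x z)
    (hsmul : ∀ (a : ℂ) (x y : E), β x (a • y) = a * β x y)
    (hherm : ∀ x y : E, β x y = starRingEnd ℂ (β y x))
    (hbound : ∀ x : E, ‖β x x‖ ≤ c * ‖x‖ ^ 2) (x y : E) :
    ‖β x y + β y x‖ ≤ c * (‖x‖ ^ 2 + ‖y‖ ^ 2) := by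
  have hadd_left (u v w : E) : β (u + v) w = β u w + β v w := by
    rw [hherm, hadd, map_add, ← hherm, ← hherm]
  have hneg (u v : E) : β u (-v) = -β u v := by
    simpa using hsmul (-1) u v
  have hneg_left (u v : E) : β (-u) v = -β u v := by
    rw [hherm, hneg, map_neg, ← hherm]
  have hpol : 2 * (β x y + β y x) = β (x + y) (x + y) - β (x - y) (x - y) := by
    simp only [sub_eq_add_neg x y, hadd, hadd_left, hneg, hneg_left]
    ring
  have hnorm : 2 * ‖β x y + β y x‖ ≤ c * ‖x + y‖ ^ 2 + c * ‖x - y‖ ^ 2 := by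
    calc 2 * ‖β x y + β y x‖ = ‖β (x + y) (x + y) - β (x - y) (x - y)‖ := by
          rw [← hpol, norm_mul, Complex.norm_two]
      _ ≤ _ := (norm_sub_le _ _).trans (add_le_add (hbound _) (hbound _))
  linear_combination (1 / 2) * hnorm + (c / 2) * parallelogram_law_with_norm ℂ x y

/-- A Hermitian form is controlled by its quadratic form. -/
lemma norm_le_of_norm_self_le
    (hadd : ∀ x y z : E, β x (y + z) = β x y + β x z)
    (hsmul : ∀ (a : ℂ) (x y : E), β x (a • y) = a * β x y)
    (hherm : ∀ x y : E, β x y = starRingEnd ℂ (β y x))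
    (hbound : ∀ x : E, ‖β x x‖ ≤ c * ‖x‖ ^ 2) (x y : E) :
    ‖β x y‖ ≤ c * (‖x‖ ^ 2 + ‖y‖ ^ 2) := by
  have hre := norm_add_swap_le_of_norm_self_le hadd hsmul hherm hbound x y
  have him := norm_add_swap_le_of_norm_self_le hadd hsmul hherm hbound (Complex.I • x) y
  have hI : β (Complex.I • x) y = -Complex.I * β x y := by
    rw [hherm, hsmul, map_mul, Complex.conj_I, ← hherm]
  rw [norm_smul, Complex.norm_I, one_mul, hI, hsmul] at him
  have hpol : 2 * β x y =
      (β x y + β y x) + Complex.I * (-Complex.I * β x y + Complex.I * β y x) := by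
    linear_combination (β x y - β y x) * Complex.I_mul_I
  have hnorm := norm_add_le (β x y + β y x)
    (Complex.I * (-Complex.I * β x y + Complex.I * β y x))
  rw [← hpol, norm_mul, norm_mul, Complex.norm_two, Complex.norm_I, one_mul] at hnorm
  linarith

end HermitianForm


/-- Estimate (23) from the proof of Lemma 3.3: if `β` is a Hermitian sesquilinear form
on a complex inner product space with `|β(Ψ,Ψ)| ≤ c‖Ψ‖²`, and `Q` is a linear
contraction, then `|β(QΨ,Ψ)| ≤ 2c‖Ψ‖²`. -/
theorem stmt_5 {E : Type*} [NormedAddCommGroup E] [InnerProductSpace ℂ E]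
    (c : ℝ) (hc : 0 ≤ c) (β : E → E → ℂ)
    (hadd : ∀ x y z : E, β x (y + z) = β x y + β x z)
    (hsmul : ∀ (a : ℂ) (x y : E), β x (a • y) = a * β x y)
    (hherm : ∀ x y : E, β x y = starRingEnd ℂ (β y x))
    (hbound : ∀ Ψ : E, ‖β Ψ Ψ‖ ≤ c * ‖Ψ‖ ^ 2)
    (Q : E →ₗ[ℂ] E) (hQ : ∀ Ψ : E, ‖Q Ψ‖ ≤ ‖Ψ‖) :
    ∀ Ψ : E, ‖β (Q Ψ) Ψ‖ ≤ 2 * c * ‖Ψ‖ ^ 2 := by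
  intro Ψ
  calc ‖β (Q Ψ) Ψ‖ ≤ c * (‖Q Ψ‖ ^ 2 + ‖Ψ‖ ^ 2) :=
        norm_le_of_norm_self_le hadd hsmul hherm hbound _ _
    _ ≤ c * (‖Ψ‖ ^ 2 + ‖Ψ‖ ^ 2) := by
        gcongr
        exact hQ Ψ
    _ = 2 * c * ‖Ψ‖ ^ 2 := by ring
end
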